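/- arXiv:1912.10378 — 2 statements merged into one kernel-verified Lean document; each statement's English description precedes it below -/
import Mathlib

section
/- Let f, Φ ∈ OM_+^1 with Φ(0) = 0 and f(0) = 0. If f preserves σ_Φ, then for all real numbers x, y > 0: f*((Φ′)*((x + y)/2)) = (Φ′)*((f*(x) + f*(y))/2), where (Φ′)* denotes the adjoint of the transpose of Φ. -/
open Matrix Filter Set Topology
open scoped ComplexOrder

noncomputable def matFun {n : ℕ} (f : ℝ → ℝ) (A : Matrix (Fin n) (Fin n) ℂ) :
    Matrix (Fin n) (Fin n) ℂ := cfc f A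

def loewnerLE {n : ℕ} (A B : Matrix (Fin n) (Fin n) ℂ) : Prop := (B - A).PosSemidef

def OpMonotone (f : ℝ → ℝ) : Prop :=
  ∀ (n : ℕ) (A B : Matrix (Fin n) (Fin n) ℂ), A.PosDef → B.PosDef →
    loewnerLE A B → loewnerLE (matFun f A) (matFun f B)

def OMone (f : ℝ → ℝ) : Prop :=
  (∀ t : ℝ, 0 < t → 0 < f t) ∧ f 1 = 1 ∧ OpMonotone f

noncomputable def kuboMean {n : ℕ} (Φ : ℝ → ℝ) (A B : Matrix (Fin n) (Fin n) ℂ) :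
    Matrix (Fin n) (Fin n) ℂ :=
  matFun Real.sqrt A *
    matFun Φ (matFun (fun x => (Real.sqrt x)⁻¹) A * B * matFun (fun x => (Real.sqrt x)⁻¹) A) *
    matFun Real.sqrt A

def Subpreserves (Φ f : ℝ → ℝ) : Prop :=
  ∀ (n : ℕ) (A B : Matrix (Fin n) (Fin n) ℂ), A.PosDef → B.PosDef →
    loewnerLE (matFun f (kuboMean Φ A B)) (kuboMean Φ (matFun f A) (matFun f B))

def PreservesMean (Φ f : ℝ → ℝ) : Prop :=
  ∀ (n : ℕ) (A B : Matrix (Fin n) (Fin n) ℂ), A.PosDef → B.PosDef →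
    matFun f (kuboMean Φ A B) = kuboMean Φ (matFun f A) (matFun f B)

def OMTrivial (f : ℝ → ℝ) : Prop :=
  (∀ t : ℝ, 0 < t → f t = 1) ∨ (∀ t : ℝ, 0 < t → f t = t)

noncomputable def adjFun (f : ℝ → ℝ) : ℝ → ℝ := fun t => (f t⁻¹)⁻¹

noncomputable def transFun (f : ℝ → ℝ) : ℝ → ℝ := fun t => t * f t⁻¹


open scoped Matrix.Norms.L2Operator in
theorem Matrix.tendsto_cfc_of_posSemidef {n : ℕ} {ι : Type*} {l : Filter ι}
    {M : ι → Matrix (Fin n) (Fin n) ℂ} {M₀ : Matrix (Fin n) (Fin n) ℂ} {g : ℝ → ℝ}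
    (hg : ContinuousOn g (Ici 0)) (hM : Tendsto M l (𝓝 M₀))
    (hpos : ∀ᶠ i in l, (M i).PosSemidef) (h₀ : M₀.PosSemidef) :
    Tendsto (fun i => cfc g (M i)) l (𝓝 (cfc g M₀)) := by
  have spectrum_subset (N : Matrix (Fin n) (Fin n) ℂ) (hN : N.PosSemidef) :
      spectrum ℝ N ⊆ Icc 0 N.trace.re := by
    rw [hN.1.spectrum_real_eq_range_eigenvalues]
    rintro _ ⟨i, rfl⟩
    refine ⟨hN.eigenvalues_nonneg i, ?_⟩
    rw [hN.1.trace_eq_sum_eigenvalues]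
    simpa using Finset.single_le_sum (f := hN.1.eigenvalues)
      (fun j _ => hN.eigenvalues_nonneg j) (Finset.mem_univ i)
  have htr : Tendsto (fun i => (M i).trace.re) l (𝓝 M₀.trace.re) := by
    have : Continuous fun N : Matrix (Fin n) (Fin n) ℂ => N.trace.re := by fun_prop
    exact (this.tendsto M₀).comp hM
  refine Filter.Tendsto.cfc (s := Icc 0 (M₀.trace.re + 1)) (p := IsSelfAdjoint)
    isCompact_Icc g hM ?_ ?_ ?_ h₀.1 (hg.mono fun x hx => hx.1)
  · filter_upwards [hpos, htr.eventually_le_const (lt_add_one _)] with i h1 h2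
    exact (spectrum_subset _ h1).trans (Icc_subset_Icc_right h2)
  · filter_upwards [hpos] with i h1 using h1.1
  · exact (spectrum_subset _ h₀).trans (Icc_subset_Icc_right (by linarith))

theorem Matrix.PosDef.spectrum_subset_Ioi {n : ℕ} {M : Matrix (Fin n) (Fin n) ℂ}
    (hM : M.PosDef) : spectrum ℝ M ⊆ Ioi 0 := by
  rw [hM.1.spectrum_real_eq_range_eigenvalues]
  rintro _ ⟨i, rfl⟩
  exact hM.eigenvalues_pos i

theorem matFun_update_zero {n : ℕ} {M : Matrix (Fin n) (Fin n) ℂ} (hM : M.PosDef)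
    (g : ℝ → ℝ) : cfc (Function.update g 0 0) M = matFun g M :=
  cfc_congr fun _ hx => Function.update_of_ne (hM.spectrum_subset_Ioi hx).ne' _ _

theorem matFun_posDef {n : ℕ} {M : Matrix (Fin n) (Fin n) ℂ} (hM : M.PosDef) {g : ℝ → ℝ}
    (hg : ∀ t, 0 < t → 0 < g t) : (matFun g M).PosDef := by
  have hh : (matFun g M).IsHermitian := cfc_predicate (p := IsSelfAdjoint) g M
  rw [hh.posDef_iff_eigenvalues_pos]
  intro i
  have hi : hh.eigenvalues i ∈ spectrum ℝ (cfc g M) := by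
    change _ ∈ spectrum ℝ (matFun g M)
    rw [hh.spectrum_real_eq_range_eigenvalues]
    exact ⟨i, rfl⟩
  rw [cfc_map_spectrum g M (ha := hM.1.isSelfAdjoint)
    (hf := (Matrix.finite_real_spectrum).continuousOn _)] at hi
  obtain ⟨x, hx, hxi⟩ := hi
  exact hxi ▸ hg x (hM.spectrum_subset_Ioi hx)

theorem Matrix.PosDef.conj_posDef {n : ℕ} {Q S : Matrix (Fin n) (Fin n) ℂ} (hQ : Q.PosDef)
    (hS : S.PosDef) : (Q * S * Q).PosDef := by
  have h := (Matrix.IsUnit.posDef_star_right_conjugate_iff (x := S) hQ.isUnit).2 hS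
  rwa [show star Q = Q from hQ.1] at h

theorem kuboMean_posDef {n : ℕ} {A B : Matrix (Fin n) (Fin n) ℂ} (hA : A.PosDef)
    (hB : B.PosDef) {Φ : ℝ → ℝ} (hΦ : ∀ t, 0 < t → 0 < Φ t) : (kuboMean Φ A B).PosDef :=
  (matFun_posDef hA fun _ ht => Real.sqrt_pos.2 ht).conj_posDef <|
    matFun_posDef ((matFun_posDef hA fun _ ht => inv_pos.2 (Real.sqrt_pos.2 ht)).conj_posDef hB) hΦ

/-- For `a ^ 2 + b ^ 2 = 1`, the Hermitian matrix with eigenvector `(a, b)` for the eigenvalue `s`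
and eigenvector `(-b, a)` for the eigenvalue `t`. -/
def spectralMatrix (a b s t : ℝ) : Matrix (Fin 2) (Fin 2) ℂ :=
  (!![a ^ 2 * s + b ^ 2 * t, a * b * (s - t); a * b * (s - t), b ^ 2 * s + a ^ 2 * t] :
    Matrix (Fin 2) (Fin 2) ℝ).map (↑)

theorem spectralMatrix_posSemidef (a b : ℝ) {s t : ℝ} (hs : 0 ≤ s) (ht : 0 ≤ t) :
    (spectralMatrix a b s t).PosSemidef := by
  have h : spectralMatrix a b s t =
      s • vecMulVec ![(a : ℂ), b] (star ![(a : ℂ), b]) +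
        t • vecMulVec ![-(b : ℂ), a] (star ![-(b : ℂ), a]) := by
    ext i j
    fin_cases i <;> fin_cases j <;> simp [spectralMatrix, vecMulVec] <;> ring
  rw [h]
  exact ((posSemidef_vecMulVec_self_star _).smul hs).add
    ((posSemidef_vecMulVec_self_star _).smul ht)

theorem spectralMatrix_posDef {a b s t : ℝ} (hab : a ^ 2 + b ^ 2 = 1) (hs : 0 < s) (ht : 0 < t) :
    (spectralMatrix a b s t).PosDef := by
  rw [(spectralMatrix_posSemidef a b hs.le ht.le).posDef_iff_det_ne_zero]
  have h : (spectralMatrix a b s t).det = ((a ^ 2 + b ^ 2) ^ 2 * (s * t) : ℝ) := by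
    simp [spectralMatrix, det_fin_two]
    ring
  rw [h, hab]
  exact_mod_cast (by positivity : (1 : ℝ) ^ 2 * (s * t) ≠ 0)

theorem cfc_spectralMatrix {a b : ℝ} (hab : a ^ 2 + b ^ 2 = 1) (g : ℝ → ℝ) (s t : ℝ) :
    cfc g (spectralMatrix a b s t) = spectralMatrix a b (g s) (g t) := by
  have hP : IsSelfAdjoint (spectralMatrix a b 1 0) :=
    (spectralMatrix_posSemidef a b zero_le_one le_rfl).1
  have hidem : IsIdempotentElem (spectralMatrix a b 1 0) := by
    have hab' : (a : ℂ) ^ 2 + (b : ℂ) ^ 2 = 1 := by exact_mod_cast hab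
    ext i j
    fin_cases i <;> fin_cases j <;> simp [spectralMatrix, mul_apply]
    · linear_combination (a : ℂ) ^ 2 * hab'
    · linear_combination (a * b : ℂ) * hab'
    · linear_combination (a * b : ℂ) * hab'
    · linear_combination (b : ℂ) ^ 2 * hab'
  have hlin (s t : ℝ) :
      cfc (fun x => t + (s - t) * x) (spectralMatrix a b 1 0) = spectralMatrix a b s t := by
    have hab' : (a : ℂ) ^ 2 + (b : ℂ) ^ 2 = 1 := by exact_mod_cast hab
    rw [cfc_const_add _ _ _, cfc_const_mul_id _ _]
    ext i j
    fin_cases i <;> fin_cases j <;>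
      simp [spectralMatrix, Matrix.algebraMap_matrix_apply]
    · linear_combination -(t : ℂ) * hab'
    · ring
    · ring
    · linear_combination -(t : ℂ) * hab'
  have hfin (g : ℝ → ℝ) (S : Set ℝ) (hS : S.Finite) : ContinuousOn g S := hS.continuousOn _
  have hspec := hidem.spectrum_subset ℝ
  rw [← hlin s t, ← hlin (g s) (g t), ← cfc_comp g _ _ hP
    (hfin _ _ (Matrix.finite_real_spectrum.image _))]
  refine cfc_congr fun x hx => ?_
  rcases hspec hx with rfl | rfl <;> simp

theorem spectralMatrix_conj {a b a' b' s s' u v : ℝ} (h₁₁ : u ^ 2 * (a ^ 2 * s) = a' ^ 2 * s')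
    (h₁₂ : u * v * (a * b * s) = a' * b' * s') (h₂₂ : v ^ 2 * (b ^ 2 * s) = b' ^ 2 * s') :
    spectralMatrix 1 0 u v * spectralMatrix a b s 0 * spectralMatrix 1 0 u v =
      spectralMatrix a' b' s' 0 := by
  replace h₁₁ := congrArg Complex.ofReal h₁₁
  replace h₁₂ := congrArg Complex.ofReal h₁₂
  replace h₂₂ := congrArg Complex.ofReal h₂₂
  push_cast at h₁₁ h₁₂ h₂₂
  ext i j
  fin_cases i <;> fin_cases j <;> simp [spectralMatrix, mul_apply]
  · linear_combination h₁₁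
  · linear_combination h₁₂
  · linear_combination h₁₂
  · linear_combination h₂₂

theorem OpMonotone.le_of_le {f : ℝ → ℝ} (hf : OpMonotone f) {s t : ℝ} (hs : 0 < s) (hst : s ≤ t) :
    f s ≤ f t := by
  have hab : (1 : ℝ) ^ 2 + 0 ^ 2 = 1 := by norm_num
  have ht := hs.trans_le hst
  have h := hf 2 (spectralMatrix 1 0 s s) (spectralMatrix 1 0 t t)
    (spectralMatrix_posDef hab hs hs) (spectralMatrix_posDef hab ht ht) (by
      have : spectralMatrix 1 0 t t - spectralMatrix 1 0 s s =
          spectralMatrix 1 0 (t - s) (t - s) := by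
        ext i j
        fin_cases i <;> fin_cases j <;> simp [spectralMatrix]
      rw [loewnerLE, this]
      exact spectralMatrix_posSemidef _ _ (sub_nonneg.2 hst) (sub_nonneg.2 hst))
  rw [loewnerLE, matFun, matFun, cfc_spectralMatrix hab, cfc_spectralMatrix hab] at h
  have h0 := h.diag_nonneg (i := 0)
  simp only [spectralMatrix, Matrix.sub_apply, map_apply, of_apply, cons_val', cons_val_zero,
    ← Complex.ofReal_sub, Complex.zero_le_real] at h0
  linarith

theorem OpMonotone.mul_le_of_mul_lt {f : ℝ → ℝ} (hf : OpMonotone f)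
    (hpos : ∀ t, 0 < t → 0 < f t) {c p t : ℝ} (hc : 0 ≤ c) (hc1 : c ≤ 1) (hp : 0 < p)
    (ht : 0 < t) (hcp : c * t < p) : c * f t ≤ f p := by
  set a := √c
  set b := √(1 - c)
  have ha : a ^ 2 = c := Real.sq_sqrt hc
  have hb : b ^ 2 = 1 - c := Real.sq_sqrt (by linarith)
  have hab : a ^ 2 + b ^ 2 = 1 := by rw [ha, hb]; ring
  have hab0 : (1 : ℝ) ^ 2 + 0 ^ 2 = 1 := by norm_num
  obtain ⟨δ, hδ, hδp⟩ : ∃ δ, 0 < δ ∧ δ < p - c * t := exists_between (sub_pos.2 hcp)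
  set m := p - (c * t + (1 - c) * δ)
  have hm : 0 < m := by simp only [m]; nlinarith
  set w := a * b * (t - δ)
  set q := (1 - c) * t + c * δ + w ^ 2 / m
  have hq : 0 < q := by
    have h1 : 0 ≤ w ^ 2 / m := by positivity
    have h2 : 0 < (1 - c) * t + c * δ := by
      rcases hc.eq_or_lt with rfl | hc'
      · simpa
      · have := mul_nonneg (sub_nonneg.2 hc1) ht.le
        positivity
    simp only [q]; linarith
  have h := hf 2 (spectralMatrix a b t δ) (spectralMatrix 1 0 p q)
    (spectralMatrix_posDef hab ht hδ) (spectralMatrix_posDef hab0 hp hq) (by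
      have : spectralMatrix 1 0 p q - spectralMatrix a b t δ =
          m⁻¹ • vecMulVec ![(m : ℂ), -w] (star ![(m : ℂ), -w]) := by
        ext i j
        fin_cases i <;> fin_cases j <;>
          simp [spectralMatrix, vecMulVec]
        all_goals norm_cast
        · rw [ha, hb]; field_simp; ring
        · field_simp; ring
        · field_simp; ring
        · rw [ha, hb]; simp only [q]; field_simp; ring
      rw [loewnerLE, this]
      exact (posSemidef_vecMulVec_self_star _).smul (inv_nonneg.2 hm.le))
  rw [loewnerLE, matFun, matFun, cfc_spectralMatrix hab, cfc_spectralMatrix hab0] at h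
  have h0 := h.diag_nonneg (i := 0)
  simp only [spectralMatrix, Matrix.sub_apply, map_apply, of_apply, cons_val', cons_val_zero,
    ← Complex.ofReal_sub, Complex.zero_le_real, ha, hb] at h0
  have := mul_nonneg (sub_nonneg.2 hc1) (hpos δ hδ).le
  linarith

theorem OpMonotone.mul_le_mul {f : ℝ → ℝ} (hf : OpMonotone f)
    (hpos : ∀ t, 0 < t → 0 < f t) {p t : ℝ} (hp : 0 < p) (hpt : p ≤ t) :
    p * f t ≤ t * f p := by
  have ht := hp.trans_le hpt
  by_contra! hlt
  obtain ⟨c, hc1, hc2⟩ : ∃ c, f p / f t < c ∧ c < p / t :=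
    exists_between (by rw [div_lt_div_iff₀ (hpos t ht) ht]; linarith)
  have h := hf.mul_le_of_mul_lt hpos (c := c) ((div_pos (hpos p hp) (hpos t ht)).trans hc1).le
    (hc2.le.trans ((div_le_one ht).2 hpt)) hp ht ((lt_div_iff₀ ht).1 hc2)
  exact h.not_gt ((div_lt_iff₀ (hpos t ht)).1 hc1)

theorem OMone.continuousAt {f : ℝ → ℝ} (hf : OMone f) {t : ℝ} (ht : 0 < t) :
    ContinuousAt f t := by
  have hlow : Tendsto (fun s => f t * min 1 (s / t)) (𝓝 t) (𝓝 (f t)) := by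
    have h : ContinuousAt (fun s => f t * min 1 (s / t)) t := by fun_prop
    simpa [ContinuousAt, ht.ne'] using h
  have hup : Tendsto (fun s => f t * max 1 (s / t)) (𝓝 t) (𝓝 (f t)) := by
    have h : ContinuousAt (fun s => f t * max 1 (s / t)) t := by fun_prop
    simpa [ContinuousAt, ht.ne'] using h
  have hft := hf.1 t ht
  refine tendsto_of_tendsto_of_tendsto_of_le_of_le' hlow hup ?_ ?_ <;>
    filter_upwards [lt_mem_nhds ht] with s hs <;> rcases le_total s t with hst | hst
  · have := hf.2.2.mul_le_mul hf.1 hs hst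
    refine (mul_le_mul_of_nonneg_left (min_le_right _ _) hft.le).trans ?_
    rw [← mul_div_assoc, div_le_iff₀ ht]; linarith
  · exact (mul_le_mul_of_nonneg_left (min_le_left _ _) hft.le).trans
      (by simpa using hf.2.2.le_of_le ht hst)
  · exact le_trans (by simpa using hf.2.2.le_of_le hs hst)
      (mul_le_mul_of_nonneg_left (le_max_left _ _) hft.le)
  · have := hf.2.2.mul_le_mul hf.1 ht hst
    refine le_trans ?_ (mul_le_mul_of_nonneg_left (le_max_right _ _) hft.le)
    rw [← mul_div_assoc, le_div_iff₀ ht]; linarith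

theorem OMone.continuousOn_update {f : ℝ → ℝ} (hf : OMone f) (hf0 : Tendsto f (𝓝[>] 0) (𝓝 0)) :
    ContinuousOn (Function.update f 0 0) (Ici 0) := by
  intro t ht
  rcases (mem_Ici.1 ht).eq_or_lt with rfl | ht
  · rwa [continuousWithinAt_update_same, Ici_sdiff_left]
  · exact ((continuousAt_update_of_ne ht.ne').2 (hf.continuousAt ht)).continuousWithinAt

/-- The limit of `A σ_Φ B` for diagonal `A` as `B` degenerates to the projection onto `(1, 1)`. -/
theorem tendsto_kuboMean_projection {Φ : ℝ → ℝ} (hΦ : OMone Φ) (hΦ0 : Tendsto Φ (𝓝[>] 0) (𝓝 0))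
    {x y : ℝ} (hx : 0 < x) (hy : 0 < y) {l : Filter ℝ} {δ : ℝ → ℝ} (hδ : Tendsto δ l (𝓝[>] 0)) :
    Tendsto (fun ε => kuboMean Φ (spectralMatrix 1 0 x⁻¹ y⁻¹) (spectralMatrix √2⁻¹ √2⁻¹ 1 (δ ε))) l
      (𝓝 (spectralMatrix √2⁻¹ √2⁻¹ (Φ ((x + y) / 2) / ((x + y) / 2)) 0)) := by
  have hab0 : (1 : ℝ) ^ 2 + 0 ^ 2 = 1 := by norm_num
  have hr2 : √(2⁻¹ : ℝ) ^ 2 = 2⁻¹ := Real.sq_sqrt (by norm_num)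
  have hr : √(2⁻¹ : ℝ) ^ 2 + √2⁻¹ ^ 2 = 1 := by rw [hr2]; norm_num
  set s := (x + y) / 2
  have hs : 0 < s := by simp only [s]; positivity
  set a := √(x / (x + y))
  set b := √(y / (x + y))
  have hxy : 0 < x + y := by positivity
  have ha : a ^ 2 = x / (x + y) := Real.sq_sqrt (by positivity)
  have hb : b ^ 2 = y / (x + y) := Real.sq_sqrt (by positivity)
  have hab : a ^ 2 + b ^ 2 = 1 := by rw [ha, hb]; field_simp
  have hamul : a * b = √x * √y / (x + y) := by
    simp only [a, b]
    rw [Real.sqrt_div hx.le, Real.sqrt_div hy.le, div_mul_div_comm, Real.mul_self_sqrt hxy.le]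
  have hsx : √x ^ 2 = x := Real.sq_sqrt hx.le
  have hsy : √y ^ 2 = y := Real.sq_sqrt hy.le
  have hA : (spectralMatrix 1 0 x⁻¹ y⁻¹).PosDef :=
    spectralMatrix_posDef hab0 (inv_pos.2 hx) (inv_pos.2 hy)
  have hδ0 : Tendsto δ l (𝓝 0) := hδ.mono_right nhdsWithin_le_nhds
  have hδpos : ∀ᶠ ε in l, 0 < δ ε := hδ.eventually self_mem_nhdsWithin
  have hB : Tendsto (fun ε => spectralMatrix √2⁻¹ √2⁻¹ 1 (δ ε)) l
      (𝓝 (spectralMatrix √2⁻¹ √2⁻¹ 1 0)) := by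
    have h : Continuous (spectralMatrix √2⁻¹ √2⁻¹ 1) := by
      refine continuous_matrix fun i j => ?_
      fin_cases i <;> fin_cases j <;> simp [spectralMatrix] <;> fun_prop
    exact (h.tendsto 0).comp hδ0
  set Q := matFun (fun x => (√x)⁻¹) (spectralMatrix 1 0 x⁻¹ y⁻¹)
  have hQpos : Q.PosDef := matFun_posDef hA fun _ ht => inv_pos.2 (Real.sqrt_pos.2 ht)
  have hQ : Q = spectralMatrix 1 0 √x √y := by
    simp only [Q, matFun]
    rw [cfc_spectralMatrix hab0]
    simp
  have hC0 : Q * spectralMatrix √2⁻¹ √2⁻¹ 1 0 * Q = spectralMatrix a b s 0 := by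
    rw [hQ]
    apply spectralMatrix_conj
    · rw [hsx, hr2, ha]; simp only [s]; field_simp
    · rw [← sq, hr2, hamul]; simp only [s]; field_simp
    · rw [hsy, hr2, hb]; simp only [s]; field_simp
  have hC : Tendsto (fun ε => Q * spectralMatrix √2⁻¹ √2⁻¹ 1 (δ ε) * Q) l
      (𝓝 (spectralMatrix a b s 0)) := by
    rw [← hC0]
    exact (hB.const_mul Q).mul_const Q
  have hCpos : ∀ᶠ ε in l, (Q * spectralMatrix √2⁻¹ √2⁻¹ 1 (δ ε) * Q).PosDef := by
    filter_upwards [hδpos] with ε hε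
    exact hQpos.conj_posDef (spectralMatrix_posDef hr one_pos hε)
  have hlim := tendsto_cfc_of_posSemidef (hΦ.continuousOn_update hΦ0) hC
    (hCpos.mono fun _ h => h.posSemidef) (spectralMatrix_posSemidef a b hs.le le_rfl)
  rw [cfc_spectralMatrix hab, Function.update_self, Function.update_of_ne hs.ne'] at hlim
  have hR : matFun Real.sqrt (spectralMatrix 1 0 x⁻¹ y⁻¹) = spectralMatrix 1 0 (√x)⁻¹ (√y)⁻¹ := by
    rw [matFun, cfc_spectralMatrix hab0]
    simp
  have hval : spectralMatrix √2⁻¹ √2⁻¹ (Φ s / s) 0 =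
      matFun Real.sqrt (spectralMatrix 1 0 x⁻¹ y⁻¹) * spectralMatrix a b (Φ s) 0 *
        matFun Real.sqrt (spectralMatrix 1 0 x⁻¹ y⁻¹) := by
    rw [hR]
    refine (spectralMatrix_conj ?_ ?_ ?_).symm
    · rw [inv_pow, hsx, hr2, ha]; simp only [s]; field_simp
    · rw [← sq √2⁻¹, hr2, hamul]; simp only [s]; field_simp
    · rw [inv_pow, hsy, hr2, hb]; simp only [s]; field_simp
  rw [hval]
  refine ((hlim.const_mul _).mul_const _).congr' ?_
  filter_upwards [hCpos] with ε hε
  rw [matFun_update_zero hε]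
  rfl

theorem stmt_8 (f Φ : ℝ → ℝ) (hf : OMone f) (hΦ : OMone Φ)
    (hΦ0 : Filter.Tendsto Φ (nhdsWithin 0 (Set.Ioi 0)) (nhds 0))
    (hf0 : Filter.Tendsto f (nhdsWithin 0 (Set.Ioi 0)) (nhds 0))
    (hpres : PreservesMean Φ f) :
    ∀ x y : ℝ, 0 < x → 0 < y →
      adjFun f (adjFun (transFun Φ) ((x + y) / 2)) =
        adjFun (transFun Φ) ((adjFun f x + adjFun f y) / 2) := by
  intro x y hx hy
  have hab0 : (1 : ℝ) ^ 2 + 0 ^ 2 = 1 := by norm_num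
  have hr2 : √(2⁻¹ : ℝ) ^ 2 = 2⁻¹ := Real.sq_sqrt (by norm_num)
  have hr : √(2⁻¹ : ℝ) ^ 2 + √2⁻¹ ^ 2 = 1 := by rw [hr2]; norm_num
  have hfx : 0 < f x⁻¹ := hf.1 _ (inv_pos.2 hx)
  have hfy : 0 < f y⁻¹ := hf.1 _ (inv_pos.2 hy)
  have hs : 0 < (x + y) / 2 := by positivity
  have hA := spectralMatrix_posDef hab0 (inv_pos.2 hx) (inv_pos.2 hy)
  have hB {ε : ℝ} (hε : 0 < ε) := spectralMatrix_posDef hr one_pos hε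
  have hΦs : 0 < Φ ((x + y) / 2) / ((x + y) / 2) := div_pos (hΦ.1 _ hs) hs
  have hleft := tendsto_cfc_of_posSemidef (hf.continuousOn_update hf0)
    (tendsto_kuboMean_projection hΦ hΦ0 hx hy tendsto_id)
    (by filter_upwards [self_mem_nhdsWithin] with ε hε
        exact (kuboMean_posDef hA (hB hε) hΦ.1).posSemidef)
    (spectralMatrix_posSemidef _ _ hΦs.le le_rfl)
  rw [cfc_spectralMatrix hr, Function.update_self, Function.update_of_ne hΦs.ne'] at hleft
  have hf0' : Tendsto f (𝓝[>] 0) (𝓝[>] 0) := tendsto_nhdsWithin_iff.2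
    ⟨hf0, by filter_upwards [self_mem_nhdsWithin] with ε hε using hf.1 ε hε⟩
  have hright := tendsto_kuboMean_projection hΦ hΦ0 (inv_pos.2 hfx) (inv_pos.2 hfy) hf0'
  rw [inv_inv, inv_inv] at hright
  have heq := tendsto_nhds_unique (hleft.congr' (by
    filter_upwards [self_mem_nhdsWithin] with ε hε
    rw [id, matFun_update_zero (kuboMean_posDef hA (hB hε) hΦ.1), hpres 2 _ _ hA (hB hε),
      matFun, matFun, cfc_spectralMatrix hab0, cfc_spectralMatrix hr, hf.2.1])) hright
  have h00 := congrFun (congrFun heq 0) 0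
  simp only [spectralMatrix, map_apply, of_apply, cons_val', cons_val_zero, mul_zero, add_zero,
    hr2, Complex.ofReal_inj] at h00
  have hfinal := mul_left_cancel₀ (by norm_num) h00
  simp only [adjFun, transFun, inv_inv, mul_inv]
  rw [div_eq_mul_inv (Φ _), div_eq_mul_inv (Φ _), mul_comm (Φ _), mul_comm (Φ _)] at hfinal
  rw [hfinal, mul_inv, inv_inv]
end

section
/- Let f and Φ be non-trivial functions in OM_+^1 with Φ*(0) = 0. Then the following are equivalent: (I) f preserves σ_Φ; (II) there exist α, β ∈ (0,1) such that Φ = f_{∇_α} and f = f_{∇_β}. -/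
open Matrix Filter Set Topology
open scoped ComplexOrder

noncomputable def arithRep (a : ℝ) : ℝ → ℝ := fun t => (1 - a) + a * t


section MatrixCalculus

variable {n : ℕ} {A B : Matrix (Fin n) (Fin n) ℂ}

theorem pos_of_mem_spectrum (hA : A.PosDef) {x : ℝ} (hx : x ∈ spectrum ℝ A) : 0 < x := by
  rw [hA.isHermitian.spectrum_real_eq_range_eigenvalues] at hx
  obtain ⟨i, rfl⟩ := hx
  exact hA.eigenvalues_pos i

theorem continuousOn_spectrum (k : ℝ → ℝ) : ContinuousOn k (spectrum ℝ A) :=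
  A.finite_real_spectrum.continuousOn k

theorem matFun_congr {k l : ℝ → ℝ} (hA : A.PosDef) (h : ∀ t, 0 < t → k t = l t) :
    matFun k A = matFun l A :=
  cfc_congr fun _ hx => h _ (pos_of_mem_spectrum hA hx)

theorem isHermitian_matFun (k : ℝ → ℝ) (A : Matrix (Fin n) (Fin n) ℂ) :
    (matFun k A).IsHermitian :=
  cfc_predicate k A

theorem matFun_affine (hA : A.IsHermitian) (a b : ℝ) :
    matFun (fun t => a + b * t) A = a • (1 : Matrix (Fin n) (Fin n) ℂ) + b • A := by
  have hA' : IsSelfAdjoint A := hA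
  rw [matFun, cfc_const_add a (fun t => b * t) A, cfc_const_mul_id b A, Algebra.algebraMap_eq_smul_one]

theorem matFun_mul (hA : A.IsHermitian) (k l : ℝ → ℝ) :
    matFun (fun t => k t * l t) A = matFun k A * matFun l A := by
  have hA' : IsSelfAdjoint A := hA
  exact cfc_mul k l A (continuousOn_spectrum k) (continuousOn_spectrum l)

theorem matFun_comp (hA : A.IsHermitian) (k l : ℝ → ℝ) :
    matFun (fun t => k (l t)) A = matFun k (matFun l A) := by
  have hA' : IsSelfAdjoint A := hA
  exact cfc_comp k l A hA' ((A.finite_real_spectrum.image l).continuousOn k)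
    (continuousOn_spectrum l)

theorem matFun_id (hA : A.IsHermitian) : matFun (fun t => t) A = A :=
  cfc_id' ℝ A hA

theorem matFun_eq_one (hA : A.PosDef) {k : ℝ → ℝ} (h : ∀ t, 0 < t → k t = 1) :
    matFun k A = 1 := by
  have hA' : IsSelfAdjoint A := hA.isHermitian
  rw [matFun_congr hA (l := fun _ => 1) h]
  exact cfc_const_one ℝ A

theorem sqrt_mul_invSqrt (hA : A.PosDef) :
    matFun Real.sqrt A * matFun (fun x => (Real.sqrt x)⁻¹) A = 1 := by
  rw [← matFun_mul hA.isHermitian]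
  exact matFun_eq_one hA fun t ht => mul_inv_cancel₀ (Real.sqrt_pos.2 ht).ne'

theorem invSqrt_mul_sqrt (hA : A.PosDef) :
    matFun (fun x => (Real.sqrt x)⁻¹) A * matFun Real.sqrt A = 1 :=
  mul_eq_one_comm.1 (sqrt_mul_invSqrt hA)

theorem sqrt_mul_sqrt (hA : A.PosDef) : matFun Real.sqrt A * matFun Real.sqrt A = A := by
  rw [← matFun_mul hA.isHermitian]
  conv_rhs => rw [← matFun_id hA.isHermitian]
  exact matFun_congr hA fun t ht => Real.mul_self_sqrt ht.le

theorem posDef_matFun (hA : A.PosDef) {k : ℝ → ℝ} (h : ∀ t, 0 < t → 0 < k t) :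
    (matFun k A).PosDef := by
  have hA' : IsSelfAdjoint A := hA.isHermitian
  rw [(isHermitian_matFun k A).posDef_iff_eigenvalues_pos]
  intro i
  have hs : spectrum ℝ (matFun k A) = k '' spectrum ℝ A :=
    cfc_map_spectrum k A hA' (continuousOn_spectrum k)
  have hi := (isHermitian_matFun k A).eigenvalues_mem_spectrum_real i
  rw [hs] at hi
  obtain ⟨x, hx, hxi⟩ := hi
  exact hxi ▸ h x (pos_of_mem_spectrum hA hx)

theorem posDef_conj (hA : A.PosDef) (hB : B.PosDef) :
    (matFun (fun x => (Real.sqrt x)⁻¹) A * B * matFun (fun x => (Real.sqrt x)⁻¹) A).PosDef := by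
  have h := hB.conjTranspose_mul_mul_same (B := matFun (fun x => (Real.sqrt x)⁻¹) A)
    (Matrix.mulVec_injective_of_isUnit (IsUnit.of_mul_eq_one _ (invSqrt_mul_sqrt hA)))
  rwa [(isHermitian_matFun _ A).eq] at h

theorem posDef_kuboMean (hA : A.PosDef) (hB : B.PosDef) {Φ : ℝ → ℝ} (h : ∀ t, 0 < t → 0 < Φ t) :
    (kuboMean Φ A B).PosDef := by
  have h := (posDef_matFun (posDef_conj hA hB) h).conjTranspose_mul_mul_same
    (B := matFun Real.sqrt A)
    (Matrix.mulVec_injective_of_isUnit (IsUnit.of_mul_eq_one _ (sqrt_mul_invSqrt hA)))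
  rwa [(isHermitian_matFun _ A).eq] at h

theorem kuboMean_congr (hA : A.PosDef) (hB : B.PosDef) {Φ Ψ : ℝ → ℝ}
    (h : ∀ t, 0 < t → Φ t = Ψ t) : kuboMean Φ A B = kuboMean Ψ A B := by
  rw [kuboMean, kuboMean, matFun_congr (posDef_conj hA hB) h]

theorem kuboMean_affine (hA : A.PosDef) (hB : B.PosDef) (a b : ℝ) :
    kuboMean (fun t => a + b * t) A B = a • A + b • B := by
  have h1 := sqrt_mul_invSqrt hA
  have h2 := invSqrt_mul_sqrt hA
  have h3 := sqrt_mul_sqrt hA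
  rw [kuboMean, matFun_affine (posDef_conj hA hB).isHermitian]
  set S := matFun Real.sqrt A
  set R := matFun (fun x => (Real.sqrt x)⁻¹) A
  have : S * (R * B * R) * S = B := by
    calc S * (R * B * R) * S = (S * R) * B * (R * S) := by simp only [mul_assoc]
      _ = B := by rw [h1, h2, one_mul, mul_one]
  rw [mul_add, add_mul, mul_smul_comm, smul_mul_assoc, mul_one, h3, mul_smul_comm, smul_mul_assoc,
    this]

theorem continuous_matFun {X : Type*} [TopologicalSpace X] {k : ℝ → ℝ} (hk : Continuous k)
    {M : X → Matrix (Fin n) (Fin n) ℂ} (hM : Continuous M) (hM' : ∀ x, (M x).IsHermitian) :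
    Continuous fun x => matFun k (M x) := by
  open scoped Matrix.Norms.L2Operator in
  exact Continuous.cfc_of_mem_nhdsSet (s := Set.univ) k Filter.univ_mem hM hM' hk.continuousOn

theorem matFun_proj {P : Matrix (Fin n) (Fin n) ℂ} (hP : P.IsHermitian) (hPP : P * P = P)
    (k : ℝ → ℝ) (s e : ℝ) :
    matFun k (s • P + e • (1 - P)) = k s • P + k e • (1 - P) := by
  set M := s • P + e • (1 - P) with hM
  have hMH : IsSelfAdjoint M :=
    (IsSelfAdjoint.smul (IsSelfAdjoint.all s) hP).add
      (IsSelfAdjoint.smul (IsSelfAdjoint.all e) ((IsSelfAdjoint.one _).sub hP))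
  have hq : (spectrum ℝ M).EqOn (fun t => t * t) (fun t => -(s * e) + (s + e) * t) := by
    refine eqOn_of_cfc_eq_cfc ?_ (by fun_prop) (by fun_prop) hMH
    have h1 := matFun_mul hMH (fun t => t) (fun t => t)
    have h2 := matFun_affine hMH (-(s * e)) (s + e)
    simp only [matFun_id hMH] at h1
    rw [matFun] at h1 h2
    rw [h1, h2, hM]
    simp only [add_mul, mul_add, smul_mul_assoc, mul_smul_comm, mul_sub, sub_mul, mul_one, one_mul,
      hPP, sub_self, smul_zero, add_zero]
    module
  obtain ⟨a, b, ha, hb⟩ : ∃ a b : ℝ, a + b * s = k s ∧ a + b * e = k e := by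
    by_cases hse : s = e
    · exact ⟨k s, 0, by simp, by simp [hse]⟩
    · have : s - e ≠ 0 := sub_ne_zero.2 hse
      exact ⟨k s - (k s - k e) / (s - e) * s, (k s - k e) / (s - e), by ring, by field_simp; ring⟩
  have : matFun k M = matFun (fun t => a + b * t) M := by
    refine cfc_congr fun t ht => ?_
    have h := hq ht
    have h0 : (t - s) * (t - e) = 0 := by simp only at h; linear_combination h
    rcases mul_eq_zero.1 h0 with h | h
    · simp only [sub_eq_zero.1 h, ha]
    · simp only [sub_eq_zero.1 h, hb]
  rw [this, matFun_affine hMH, ← ha, ← hb, hM]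
  module

theorem matFun_smul_one (k : ℝ → ℝ) (s : ℝ) :
    matFun k (s • (1 : Matrix (Fin n) (Fin n) ℂ)) = k s • (1 : Matrix (Fin n) (Fin n) ℂ) := by
  simpa using matFun_proj (P := (1 : Matrix (Fin n) (Fin n) ℂ)) isHermitian_one (one_mul 1) k s 0

theorem posDef_smul_one {s : ℝ} (hs : 0 < s) : (s • (1 : Matrix (Fin n) (Fin n) ℂ)).PosDef := by
  have h := (Matrix.PosDef.one (n := Fin n) (R := ℂ)).smul (a := (s : ℂ)) (by exact_mod_cast hs)
  simpa using h

theorem matFun_inv (hA : A.PosDef) : matFun (fun t => t⁻¹) A = A⁻¹ := by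
  refine (Matrix.inv_eq_right_inv ?_).symm
  conv_lhs => enter [1]; rw [← matFun_id hA.isHermitian]
  rw [← matFun_mul hA.isHermitian]
  exact matFun_eq_one hA fun t ht => mul_inv_cancel₀ ht.ne'

theorem matFun_adjFun (hA : A.PosDef) {f : ℝ → ℝ} (hf : ∀ t, 0 < t → 0 < f t) :
    matFun (adjFun f) A = (matFun f A⁻¹)⁻¹ := by
  refine (Matrix.inv_eq_left_inv ?_).symm
  rw [← matFun_inv hA, ← matFun_comp hA.isHermitian, ← matFun_mul hA.isHermitian]
  exact matFun_eq_one hA fun t ht => inv_mul_cancel₀ (hf _ (inv_pos.2 ht)).ne'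

theorem matFun_sqrt_inv (hA : A.PosDef) :
    matFun Real.sqrt A⁻¹ = matFun (fun x => (Real.sqrt x)⁻¹) A := by
  rw [← matFun_inv hA, ← matFun_comp hA.isHermitian]
  exact matFun_congr hA fun t _ => Real.sqrt_inv t

theorem matFun_invSqrt_inv (hA : A.PosDef) :
    matFun (fun x => (Real.sqrt x)⁻¹) A⁻¹ = matFun Real.sqrt A := by
  rw [← matFun_inv hA, ← matFun_comp hA.isHermitian]
  exact matFun_congr hA fun t _ => by rw [Real.sqrt_inv, inv_inv]

theorem kuboMean_adjFun (hA : A.PosDef) (hB : B.PosDef) {Φ : ℝ → ℝ}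
    (hΦ : ∀ t, 0 < t → 0 < Φ t) :
    kuboMean (adjFun Φ) A B = (kuboMean Φ A⁻¹ B⁻¹)⁻¹ := by
  have hS := Matrix.inv_eq_left_inv (sqrt_mul_invSqrt hA)
  rw [kuboMean, kuboMean, matFun_sqrt_inv hA, matFun_invSqrt_inv hA,
    matFun_adjFun (posDef_conj hA hB) hΦ]
  simp only [Matrix.mul_inv_rev, hS, mul_assoc]

theorem PreservesMean.adjoint {Φ f : ℝ → ℝ} (hΦ : ∀ t, 0 < t → 0 < Φ t)
    (hf : ∀ t, 0 < t → 0 < f t) (h : PreservesMean Φ f) :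
    PreservesMean (adjFun Φ) (adjFun f) := by
  intro n A B hA hB
  have hpos : ∀ k : ℝ → ℝ, (∀ t, 0 < t → 0 < k t) → ∀ t, 0 < t → 0 < adjFun k t :=
    fun k hk t ht => inv_pos.2 (hk _ (inv_pos.2 ht))
  have hinv : ∀ M : Matrix (Fin n) (Fin n) ℂ, M.PosDef → M⁻¹⁻¹ = M := fun M hM =>
    Matrix.nonsing_inv_nonsing_inv _ ((Matrix.isUnit_iff_isUnit_det _).1 hM.isUnit)
  have hA' := posDef_matFun hA.inv hf
  have hB' := posDef_matFun hB.inv hf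
  rw [matFun_adjFun (posDef_kuboMean hA hB (hpos Φ hΦ)) hf, kuboMean_adjFun hA hB hΦ,
    hinv _ (posDef_kuboMean hA.inv hB.inv hΦ), h n _ _ hA.inv hB.inv, matFun_adjFun hA hf,
    matFun_adjFun hB hf, kuboMean_adjFun hA'.inv hB'.inv hΦ, hinv _ hA', hinv _ hB']

end MatrixCalculus

section TwoByTwo

/-- The real symmetric matrix with rows `(a, b)` and `(b, d)`. -/
def symMat (a b d : ℝ) : Matrix (Fin 2) (Fin 2) ℂ := !![(a : ℂ), b; b, d]

theorem symMat_isHermitian (a b d : ℝ) : (symMat a b d).IsHermitian := by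
  ext i j
  fin_cases i <;> fin_cases j <;> simp [symMat]

theorem symMat_add (a b d a' b' d' : ℝ) :
    symMat a b d + symMat a' b' d' = symMat (a + a') (b + b') (d + d') := by
  ext i j
  fin_cases i <;> fin_cases j <;> simp [symMat]

theorem symMat_sub (a b d a' b' d' : ℝ) :
    symMat a b d - symMat a' b' d' = symMat (a - a') (b - b') (d - d') := by
  ext i j
  fin_cases i <;> fin_cases j <;> simp [symMat]

theorem smul_symMat (c a b d : ℝ) : c • symMat a b d = symMat (c * a) (c * b) (c * d) := by
  ext i j
  fin_cases i <;> fin_cases j <;> simp [symMat]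

theorem one_eq_symMat : (1 : Matrix (Fin 2) (Fin 2) ℂ) = symMat 1 0 1 := by
  ext i j
  fin_cases i <;> fin_cases j <;> simp [symMat]

theorem symMat_det (a b d : ℝ) : (symMat a b d).det = ((a * d - b * b : ℝ) : ℂ) := by
  simp [symMat, Matrix.det_fin_two_of]

theorem symMat_posSemidef {a b d : ℝ} (ha : 0 ≤ a) (hd : 0 ≤ d) (h : b * b ≤ a * d) :
    (symMat a b d).PosSemidef := by
  have key : ∀ u w : ℝ, 0 ≤ a * (u * u) + 2 * b * (u * w) + d * (w * w) := by
    intro u w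
    rcases ha.eq_or_lt with rfl | ha
    · have : b = 0 := by nlinarith
      subst this
      nlinarith [mul_nonneg hd (mul_self_nonneg w)]
    · have : 0 ≤ a * (a * (u * u) + 2 * b * (u * w) + d * (w * w)) := by
        nlinarith [mul_self_nonneg (a * u + b * w), mul_nonneg (sub_nonneg.2 h) (mul_self_nonneg w)]
      exact nonneg_of_mul_nonneg_right this ha
  refine Matrix.PosSemidef.of_dotProduct_mulVec_nonneg (symMat_isHermitian a b d) fun v => ?_
  rw [Complex.nonneg_iff]
  simp only [symMat, dotProduct, Matrix.mulVec, Fin.sum_univ_two, Pi.star_apply, RCLike.star_def,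
    Matrix.of_apply, Matrix.cons_val', Matrix.cons_val_zero, Matrix.cons_val_one,
    Matrix.cons_val_fin_one, Complex.add_re, Complex.mul_re, Complex.add_im, Complex.mul_im,
    Complex.conj_re, Complex.conj_im, Complex.ofReal_re, Complex.ofReal_im]
  constructor
  · linarith [key (v 0).re (v 1).re, key (v 0).im (v 1).im]
  · ring

theorem symMat_posDef {a b d : ℝ} (ha : 0 < a) (hd : 0 < d) (h : b * b < a * d) :
    (symMat a b d).PosDef := by
  rw [(symMat_posSemidef ha.le hd.le h.le).posDef_iff_det_ne_zero, symMat_det]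
  exact_mod_cast (sub_pos.2 h).ne'

theorem symMat_nonneg_of_posSemidef {a b d : ℝ} (h : (symMat a b d).PosSemidef) :
    0 ≤ a ∧ 0 ≤ d ∧ b * b ≤ a * d := by
  have h0 := h.diag_nonneg (i := 0)
  have h1 := h.diag_nonneg (i := 1)
  have h2 := h.det_nonneg
  rw [symMat_det] at h2
  simp only [symMat, Matrix.of_apply, Matrix.cons_val', Matrix.cons_val_zero, Matrix.cons_val_one,
    Matrix.cons_val_fin_one] at h0 h1
  exact ⟨by exact_mod_cast h0, by exact_mod_cast h1, sub_nonneg.1 (by exact_mod_cast h2)⟩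

theorem matFun_diag (k : ℝ → ℝ) (x y : ℝ) : matFun k (symMat x 0 y) = symMat (k x) 0 (k y) := by
  have hE : ∀ a b : ℝ, symMat a 0 b = a • symMat 1 0 0 + b • (1 - symMat 1 0 0) := fun a b => by
    rw [one_eq_symMat, symMat_sub, smul_symMat, smul_symMat, symMat_add]
    congr 1 <;> ring
  rw [hE x y, hE (k x) (k y)]
  refine matFun_proj (symMat_isHermitian _ _ _) ?_ k x y
  ext i j
  fin_cases i <;> fin_cases j <;> simp [symMat]

variable {p q r : ℝ}

theorem proj_mul_diag_mul_proj (hr : r * r = p * q) (a b : ℝ) :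
    symMat p r q * symMat a 0 b * symMat p r q = (p * a + q * b) • symMat p r q := by
  have hr' : (r : ℂ) * r = p * q := by exact_mod_cast hr
  ext i j
  fin_cases i <;> fin_cases j <;> simp [symMat]
  · linear_combination (b : ℂ) * hr'
  · ring
  · ring
  · linear_combination (a : ℂ) * hr'

theorem proj_mul_proj (hpq : p + q = 1) (hr : r * r = p * q) :
    symMat p r q * symMat p r q = symMat p r q := by
  have h := proj_mul_diag_mul_proj hr 1 1
  rwa [← one_eq_symMat, mul_one, mul_one, mul_one, hpq, one_smul] at h

theorem smul_proj_add (hpq : p + q = 1) (s e : ℝ) :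
    s • symMat p r q + e • (1 - symMat p r q) =
      symMat (s * p + e * q) ((s - e) * r) (s * q + e * p) := by
  rw [one_eq_symMat, symMat_sub, smul_symMat, smul_symMat, symMat_add]
  congr 1
  · linear_combination (-e) * hpq
  · ring
  · linear_combination (-e) * hpq

theorem posDef_proj (hp : 0 ≤ p) (hq : 0 ≤ q) (hpq : p + q = 1) (hr : r * r = p * q) {s e : ℝ}
    (hs : 0 < s) (he : 0 < e) : (s • symMat p r q + e • (1 - symMat p r q)).PosDef := by
  rw [smul_proj_add hpq]
  have hpos : ∀ u w : ℝ, 0 ≤ u → 0 ≤ w → u + w = 1 → 0 < s * u + e * w := by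
    intro u w hu hw huw
    rcases hu.eq_or_lt with rfl | hu
    · rw [show w = 1 by linarith]; linarith
    · have := mul_pos hs hu
      have := mul_nonneg he.le hw
      linarith
  refine symMat_posDef (hpos p q hp hq hpq) (hpos q p hq hp (by linarith)) ?_
  have : (s * p + e * q) * (s * q + e * p) - (s - e) * r * ((s - e) * r) = s * e := by
    linear_combination (-(s - e) ^ 2) * hr + (s * e * (p + q + 1)) * hpq
  nlinarith [mul_pos hs he]

theorem matFun_symMat_proj (hpq : p + q = 1) (hr : r * r = p * q) (k : ℝ → ℝ) (s e : ℝ) :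
    matFun k (s • symMat p r q + e • (1 - symMat p r q)) =
      k s • symMat p r q + k e • (1 - symMat p r q) :=
  matFun_proj (symMat_isHermitian _ _ _) (proj_mul_proj hpq hr) k s e

end TwoByTwo

section OperatorMonotone

theorem nonpos_of_forall_le_mul {c M b : ℝ} (hb : 0 < b) (h : ∀ θ, 0 < θ → θ < b → c ≤ θ * M) :
    c ≤ 0 := by
  have ht : Tendsto (fun θ : ℝ => θ * M) (𝓝[>] 0) (𝓝 0) := by
    have : Tendsto (fun θ : ℝ => θ * M) (𝓝 0) (𝓝 (0 * M)) := (by fun_prop : Continuous _).tendsto _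
    rw [zero_mul] at this
    exact this.mono_left nhdsWithin_le_nhds
  refine ge_of_tendsto ht ?_
  filter_upwards [Ioo_mem_nhdsGT hb] with θ hθ using h θ hθ.1 hθ.2

variable {f : ℝ → ℝ}

theorem OpMonotone.monotoneOn (hf : OpMonotone f) : MonotoneOn f (Ioi 0) := by
  intro x hx y hy hxy
  have hx' : 0 < x := hx
  have hy' : 0 < y := hy
  have h := hf 2 (symMat x 0 x) (symMat y 0 y) (symMat_posDef hx' hx' (by nlinarith))
    (symMat_posDef hy' hy' (by nlinarith)) (by
      rw [loewnerLE, symMat_sub]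
      exact symMat_posSemidef (by linarith) (by linarith) (by nlinarith))
  rw [matFun_diag, matFun_diag, loewnerLE, symMat_sub] at h
  linarith [(symMat_nonneg_of_posSemidef h).1]

theorem OMone.harmonic_le (hf : OMone f) {x y s p q : ℝ} (hx : 0 < x) (hy : 0 < y) (hs : 0 < s)
    (hp : 0 < p) (hq : 0 < q) (hpq : p + q = 1) (h : s * (q * x + p * y) < x * y) :
    f s * (q * f x + p * f y) ≤ f x * f y := by
  have hr : √(p * q) * √(p * q) = p * q := Real.mul_self_sqrt (by positivity)
  set r := √(p * q)
  set e := (x * y - s * (q * x + p * y)) / (p * x + q * y) with he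
  have hden : 0 < p * x + q * y := by positivity
  have hepos : 0 < e := div_pos (by linarith) hden
  have hed : e * (p * x + q * y) = x * y - s * (q * x + p * y) := div_mul_cancel₀ _ hden.ne'
  have hqx : 0 < q * x := by positivity
  have hpy : 0 < p * y := by positivity
  have hpx : 0 < p * x := by positivity
  have hqy : 0 < q * y := by positivity
  have hle : loewnerLE (s • symMat p r q + e • (1 - symMat p r q)) (symMat x 0 y) := by
    rw [loewnerLE, smul_proj_add hpq, symMat_sub]
    refine symMat_posSemidef ?_ ?_ ?_
    · have h1 : 0 ≤ x - s * p := by nlinarith [mul_pos hs hqx]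
      have h2 : 0 ≤ y * (x - s * p) - e * (q * y) := by nlinarith [mul_pos hs hqx, mul_pos hepos hpx]
      nlinarith
    · have h1 : 0 ≤ y - s * q := by nlinarith [mul_pos hs hpy]
      have h2 : 0 ≤ x * (y - s * q) - e * (p * x) := by nlinarith [mul_pos hs hpy, mul_pos hepos hqy]
      nlinarith
    · have : (x - (s * p + e * q)) * (y - (s * q + e * p)) -
          (0 - (s - e) * r) * (0 - (s - e) * r) = s * e := by
        linear_combination (-(s - e) ^ 2) * hr + (s * e * (p + q + 1)) * hpq - hed
      nlinarith [mul_pos hs hepos]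
  have h1 := hf.2.2 2 _ _ (posDef_proj hp.le hq.le hpq hr hs hepos)
    (symMat_posDef hx hy (by nlinarith [mul_pos hx hy])) hle
  rw [matFun_symMat_proj hpq hr, matFun_diag, loewnerLE] at h1
  have h2 : (f e • (1 - symMat p r q)).PosSemidef := by
    rw [one_eq_symMat, symMat_sub, smul_symMat]
    have := hf.1 e hepos
    refine symMat_posSemidef (mul_nonneg this.le (by linarith)) (mul_nonneg this.le (by linarith)) ?_
    apply le_of_eq
    linear_combination (f e) ^ 2 * hr + (f e) ^ 2 * hpq
  have h3 := h1.add h2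
  rw [sub_add_eq_sub_sub, sub_add_cancel, smul_symMat, symMat_sub] at h3
  have h4 := (symMat_nonneg_of_posSemidef h3).2.2
  linear_combination h4 - (f s) ^ 2 * hr

theorem OMone.adjFun_pos (hf : OMone f) {t : ℝ} (ht : 0 < t) : 0 < adjFun f t :=
  inv_pos.2 (hf.1 _ (inv_pos.2 ht))

theorem OMone.adjFun_one (hf : OMone f) : adjFun f 1 = 1 := by
  rw [adjFun, inv_one, hf.2.1, inv_one]

theorem OMone.adjFun_monotoneOn (hf : OMone f) : MonotoneOn (adjFun f) (Ioi 0) := by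
  intro x hx y hy hxy
  have hx' : 0 < x := hx
  have hy' : 0 < y := hy
  exact inv_anti₀ (hf.1 _ (inv_pos.2 hy')) (hf.2.2.monotoneOn (inv_pos.2 hy') (inv_pos.2 hx')
    (inv_anti₀ hx' hxy))

theorem OMone.adjFun_concaveOn (hf : OMone f) : ConcaveOn ℝ (Ioi 0) (adjFun f) := by
  have key : ∀ u w t p q : ℝ, 0 < u → 0 < w → 0 < p → 0 < q → p + q = 1 → p * u + q * w < t →
      p * adjFun f u + q * adjFun f w ≤ adjFun f t := by
    intro u w t p q hu hw hp hq hpq ht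
    have ht0 : 0 < t := by linarith [mul_pos hp hu, mul_pos hq hw]
    have hu' := inv_pos.2 hu
    have hw' := inv_pos.2 hw
    have ht' := inv_pos.2 ht0
    have h := hf.harmonic_le hu' hw' ht' hp hq hpq (by
      field_simp
      linarith)
    have h1 := hf.1 _ hu'
    have h2 := hf.1 _ hw'
    have h3 := hf.1 _ ht'
    simp only [adjFun]
    generalize f u⁻¹ = X at *
    generalize f w⁻¹ = Y at *
    generalize f t⁻¹ = Z at *
    field_simp
    linarith
  refine LinearOrder.concaveOn_of_lt (convex_Ioi 0) fun x hx y hy hxy a b ha hb hab => ?_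
  simp only [smul_eq_mul]
  refine sub_nonpos.1 (nonpos_of_forall_le_mul (M := adjFun f y - adjFun f x) hb fun θ h0 h1 => ?_)
  have := key x y (a * x + b * y) (a + θ) (b - θ) hx hy (by linarith) (by linarith) (by linarith)
    (by nlinarith)
  linarith

theorem OpMonotone.le_affine_of_eqOn_Ici (hf : OpMonotone f) {m c K : ℝ} (hK : 0 < K) (hm : 0 ≤ m)
    (h : ∀ t, K ≤ t → f t = m * t + c) {t : ℝ} (ht : 0 < t) : f t ≤ m * t + c := by
  rcases le_or_gt K t with hKt | hKt
  · exact (h t hKt).le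
  have hb : √((2 * K - t) * K) * √((2 * K - t) * K) = (2 * K - t) * K :=
    Real.mul_self_sqrt (mul_nonneg (by linarith) hK.le)
  set b := √((2 * K - t) * K)
  have hY : (symMat (2 * K) b (3 * K)).PosDef :=
    symMat_posDef (by positivity) (by positivity) (by nlinarith [mul_pos hK ht, mul_pos hK hK])
  have hKY : (symMat (2 * K) b (3 * K) - K • 1).PosSemidef := by
    rw [one_eq_symMat, smul_symMat, symMat_sub]
    exact symMat_posSemidef (by linarith) (by linarith) (by nlinarith [mul_pos hK ht])
  have hspec : ∀ x ∈ spectrum ℝ (symMat (2 * K) b (3 * K)), K ≤ x := by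
    open scoped MatrixOrder in
    refine (algebraMap_le_iff_le_spectrum (r := K) (hY.isHermitian : IsSelfAdjoint _)).1 ?_
    rwa [Matrix.le_iff, Algebra.algebraMap_eq_smul_one]
  have hfY : matFun f (symMat (2 * K) b (3 * K)) = c • 1 + m • symMat (2 * K) b (3 * K) := by
    rw [← matFun_affine hY.isHermitian]
    exact cfc_congr fun x hx => by rw [h x (hspec x hx)]; ring
  have hle := hf 2 (symMat t 0 (2 * K)) (symMat (2 * K) b (3 * K))
    (symMat_posDef ht (by positivity) (by nlinarith [mul_pos hK ht])) hY (by
      rw [loewnerLE, symMat_sub]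
      exact symMat_posSemidef (by linarith) (by linarith) (by nlinarith))
  rw [matFun_diag, hfY, loewnerLE, one_eq_symMat, smul_symMat, smul_symMat, symMat_add, symMat_sub,
    h (2 * K) (by linarith)] at hle
  obtain ⟨h1, -, h2⟩ := symMat_nonneg_of_posSemidef hle
  rcases hm.eq_or_lt with rfl | hm
  · linarith
  · have h3 : (m * K) * (m * (2 * K - t)) ≤ (m * K) * (c * 1 + m * (2 * K) - f t) := by
      linear_combination h2 - m ^ 2 * hb
    have := le_of_mul_le_mul_left h3 (mul_pos hm hK)
    linarith

end OperatorMonotone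

section ScalarIdentities

variable {f Φ : ℝ → ℝ}

theorem kuboMean_smul_one {n : ℕ} (Φ : ℝ → ℝ) {a : ℝ} (ha : 0 < a) (b : ℝ) :
    kuboMean Φ (a • (1 : Matrix (Fin n) (Fin n) ℂ)) (b • 1) =
      (a * Φ (b / a)) • (1 : Matrix (Fin n) (Fin n) ℂ) := by
  have h := Real.mul_self_sqrt ha.le
  have h0 := (Real.sqrt_pos.2 ha).ne'
  have h1 : (√a)⁻¹ * b * (√a)⁻¹ = b / a := by
    nth_rw 3 [← h]
    field_simp
  rw [kuboMean, matFun_smul_one, matFun_smul_one]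
  simp only [smul_mul_assoc, mul_smul_comm, mul_one, smul_smul]
  rw [mul_comm b, ← mul_assoc, mul_right_comm, h1, matFun_smul_one]
  simp only [smul_smul, mul_smul_comm, mul_one]
  rw [h]

theorem PreservesMean.apply_scalar (h : PreservesMean Φ f) (hf : ∀ t, 0 < t → 0 < f t) {a b : ℝ}
    (ha : 0 < a) (hb : 0 < b) : f (a * Φ (b / a)) = f a * Φ (f b / f a) := by
  have h1 := h 1 (a • 1) (b • 1) (posDef_smul_one ha) (posDef_smul_one hb)
  rw [kuboMean_smul_one Φ ha, matFun_smul_one, matFun_smul_one, matFun_smul_one,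
    kuboMean_smul_one Φ (hf a ha)] at h1
  have h2 := congrFun (congrFun h1 0) 0
  simp only [Matrix.smul_apply, one_apply_eq, Complex.real_smul, mul_one] at h2
  exact_mod_cast h2

theorem ConcaveOn.three_point {ψ : ℝ → ℝ} (h : ConcaveOn ℝ (Ioi 0) ψ) {u v w : ℝ} (hu : 0 < u)
    (huv : u < v) (hvw : v < w) : (w - v) * ψ u + (v - u) * ψ w ≤ (w - u) * ψ v := by
  have hw : 0 < w - u := by linarith
  have h1 := h.2 (show u ∈ Ioi 0 from hu) (show w ∈ Ioi 0 from by rw [mem_Ioi]; linarith)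
    (div_nonneg (sub_nonneg.2 hvw.le) hw.le) (div_nonneg (sub_nonneg.2 huv.le) hw.le)
    (by field_simp; ring)
  have h2 : ((w - v) / (w - u)) • u + ((v - u) / (w - u)) • w = v := by
    simp only [smul_eq_mul]
    field_simp
    ring
  rw [h2] at h1
  simp only [smul_eq_mul] at h1
  have h3 := mul_le_mul_of_nonneg_left h1 hw.le
  have h4 : (w - u) * ((w - v) / (w - u) * ψ u + (v - u) / (w - u) * ψ w) =
      (w - v) * ψ u + (v - u) * ψ w := by
    field_simp
  linarith

theorem adjFun_adjFun (f : ℝ → ℝ) (t : ℝ) : adjFun (adjFun f) t = f t := by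
  simp [adjFun]

theorem OMone.adjFun_div_ne (hΦ : OMone Φ) (hnt : ¬ OMTrivial Φ) {x y : ℝ} (hx : 0 < x)
    (hxy : x < y) : adjFun Φ x / x ≠ adjFun Φ y / y := by
  intro heq
  have hy : 0 < y := hx.trans hxy
  have hc := hΦ.adjFun_concaveOn
  obtain ⟨m, hm⟩ : ∃ m, m = adjFun Φ x / x := ⟨_, rfl⟩
  have hmx : adjFun Φ x = m * x := by rw [hm]; field_simp
  have hmy : adjFun Φ y = m * y := by rw [hm, heq]; field_simp
  have hm0 : 0 < m := hm ▸ div_pos (hΦ.adjFun_pos hx) hx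
  have hlow : ∀ u, 0 < u → u < x → adjFun Φ u = m * u := by
    intro u hu hux
    refine le_antisymm ?_ ?_
    · have h := hc.three_point hu hux hxy
      rw [hmx, hmy] at h
      have : (y - x) * adjFun Φ u ≤ (y - x) * (m * u) := by linarith
      exact le_of_mul_le_mul_left this (by linarith)
    · have : x * (m * u - adjFun Φ u) ≤ 0 := by
        refine nonpos_of_forall_le_mul (M := m * x - adjFun Φ u) hu fun ε h0 h1 => ?_
        have h := hc.three_point h0 h1 hux
        have h2 := mul_pos (sub_pos.2 hux) (hΦ.adjFun_pos h0)
        rw [hmx] at h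
        linarith
      nlinarith
  have hup : ∀ u, 0 < u → adjFun Φ u ≤ m * u := by
    intro u hu
    rcases lt_trichotomy u x with h | rfl | h
    · exact (hlow u hu h).le
    · exact hmx.le
    · have h2 := hc.three_point (half_pos hx) (half_lt_self hx) h
      rw [hmx, hlow _ (half_pos hx) (half_lt_self hx)] at h2
      have : x * adjFun Φ u ≤ x * (m * u) := by linarith
      exact le_of_mul_le_mul_left this hx
  have hle : ∀ t, 0 < t → Φ t ≤ m⁻¹ * t + 0 := fun t ht => by
    refine hΦ.2.2.le_affine_of_eqOn_Ici (inv_pos.2 hx) (inv_pos.2 hm0).le (fun s hs => ?_) ht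
    have hs0 : 0 < s := (inv_pos.2 hx).trans_le hs
    have h1 : adjFun Φ s⁻¹ = m * s⁻¹ := by
      rcases (inv_le_of_inv_le₀ hx hs).lt_or_eq with h | h
      · exact hlow _ (inv_pos.2 hs0) h
      · rw [h, hmx]
    rw [← adjFun_adjFun Φ, adjFun, h1, mul_inv, inv_inv, add_zero]
  have hge : ∀ t, 0 < t → m⁻¹ * t ≤ Φ t := fun t ht => by
    rw [← adjFun_adjFun Φ, adjFun]
    have h1 := hup _ (inv_pos.2 ht)
    have h2 := inv_anti₀ (hΦ.adjFun_pos (inv_pos.2 ht)) h1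
    rwa [mul_inv, inv_inv] at h2
  have hΦeq : ∀ t, 0 < t → Φ t = m⁻¹ * t := fun t ht =>
    le_antisymm (by linarith [hle t ht]) (hge t ht)
  have hm1 : m⁻¹ = 1 := by
    have := hΦeq 1 one_pos
    rw [hΦ.2.1, mul_one] at this
    exact this.symm
  exact hnt (Or.inr fun t ht => by rw [hΦeq t ht, hm1, one_mul])

theorem OMone.adjFun_div_injOn (hΦ : OMone Φ) (hnt : ¬ OMTrivial Φ) {x y : ℝ} (hx : 0 < x)
    (hy : 0 < y) (h : adjFun Φ x / x = adjFun Φ y / y) : x = y := by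
  rcases lt_trichotomy x y with h1 | h1 | h1
  · exact (hΦ.adjFun_div_ne hnt hx h1 h).elim
  · exact h1
  · exact (hΦ.adjFun_div_ne hnt hy h1 h.symm).elim

theorem OMone.tendsto_adjFun_zero (hf : OMone f) (hΦ : OMone Φ) (hfnt : ¬ OMTrivial f)
    (hΦnt : ¬ OMTrivial Φ) (hΦ0 : Tendsto (adjFun Φ) (𝓝[>] 0) (𝓝 0))
    (h : PreservesMean Φ f) : Tendsto (adjFun f) (𝓝[>] 0) (𝓝 0) := by
  have hmono := hf.adjFun_monotoneOn
  have hbdd : BddBelow (adjFun f '' Ioi 0) := by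
    refine ⟨0, ?_⟩
    rintro _ ⟨t, ht, rfl⟩
    exact (hf.adjFun_pos ht).le
  have htend := hmono.tendsto_nhdsGT hbdd
  set c := sInf (adjFun f '' Ioi 0) with hc
  have hle : ∀ t, 0 < t → c ≤ adjFun f t := fun t ht => csInf_le hbdd ⟨t, ht, rfl⟩
  have hc0 : 0 ≤ c := le_csInf ⟨_, ⟨1, mem_Ioi.2 one_pos, rfl⟩⟩ (by
    rintro _ ⟨t, ht, rfl⟩
    exact (hf.adjFun_pos ht).le)
  rcases hc0.eq_or_lt with h0 | hcpos
  · rwa [← h0] at htend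
  exfalso
  have hadj := h.adjoint hΦ.1 hf.1
  have hcomm : ∀ b, 0 < b → adjFun f (adjFun Φ b) = adjFun Φ (adjFun f b) := fun b hb => by
    have := hadj.apply_scalar (fun t ht => hf.adjFun_pos ht) one_pos hb
    simpa [hf.adjFun_one] using this
  have hΦ0' : Tendsto (adjFun Φ) (𝓝[>] 0) (𝓝[>] 0) :=
    tendsto_nhdsWithin_iff.2 ⟨hΦ0, eventually_mem_nhdsWithin.mono fun t ht => hΦ.adjFun_pos ht⟩
  have h1 := htend.comp hΦ0'
  have hcont : ContinuousAt (adjFun Φ) c :=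
    (hΦ.adjFun_concaveOn.continuousOn isOpen_Ioi).continuousAt (Ioi_mem_nhds hcpos)
  have h2 := hcont.tendsto.comp htend
  have hfix : c = adjFun Φ c := by
    refine tendsto_nhds_unique h1 (h2.congr' ?_)
    filter_upwards [eventually_mem_nhdsWithin] with t ht using (hcomm t ht).symm
  have hc1 : c ≠ 1 := by
    intro hc1
    refine hfnt (Or.inl fun t ht => ?_)
    have hone : ∀ s, 0 < s → adjFun f s = 1 := by
      intro s hs
      refine le_antisymm ?_ (hc1 ▸ hle s hs)
      rcases le_or_gt s 1 with h | h
      · exact (hmono hs (mem_Ioi.2 one_pos) h).trans hf.adjFun_one.le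
      · have h3 := hf.adjFun_concaveOn.three_point (u := 1 / 2) (by norm_num) (by norm_num) h
        have h4 : 1 ≤ adjFun f (1 / 2) := hc1.symm.le.trans (hle _ (by norm_num))
        rw [hf.adjFun_one] at h3
        nlinarith
    rw [← adjFun_adjFun f, adjFun, hone _ (inv_pos.2 ht), inv_one]
  refine hc1 (hΦ.adjFun_div_injOn hΦnt hcpos one_pos ?_)
  rw [← hfix, hΦ.adjFun_one, div_self hcpos.ne', div_one]

end ScalarIdentities

section Projections

variable {f Φ g ψ : ℝ → ℝ}

theorem continuous_extend_zero (hc : ContinuousOn g (Ioi 0)) (h0 : Tendsto g (𝓝[>] 0) (𝓝 0)) :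
    Continuous fun t => if t ≤ 0 then 0 else g t := by
  rw [continuous_iff_continuousAt]
  intro t
  rcases lt_trichotomy t 0 with ht | rfl | ht
  · refine (continuousAt_const (y := (0 : ℝ))).congr ?_
    filter_upwards [Iio_mem_nhds ht] with s hs
    rw [if_pos (le_of_lt hs)]
  · rw [continuousAt_iff_continuous_left'_right']
    constructor
    · refine (tendsto_const_nhds (x := (0 : ℝ))).congr' ?_ |>.trans (by simp)
      filter_upwards [eventually_mem_nhdsWithin] with s hs
      rw [if_pos (le_of_lt hs)]
    · simp only [ContinuousWithinAt, le_refl, if_true]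
      refine h0.congr' ?_
      filter_upwards [eventually_mem_nhdsWithin] with s hs
      rw [if_neg (not_le.2 hs)]
  · refine (hc.continuousAt (Ioi_mem_nhds ht)).congr ?_
    filter_upwards [Ioi_mem_nhds ht] with s hs
    rw [if_neg (not_le.2 hs)]

theorem continuous_kuboMean {n : ℕ} (hψ : Continuous ψ) (A : Matrix (Fin n) (Fin n) ℂ)
    {B : ℝ → Matrix (Fin n) (Fin n) ℂ} (hB : Continuous B) (hB' : ∀ x, (B x).IsHermitian) :
    Continuous fun x => kuboMean ψ A (B x) := by
  have h : Continuous fun x => matFun ψ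
      (matFun (fun x => (Real.sqrt x)⁻¹) A * B x * matFun (fun x => (Real.sqrt x)⁻¹) A) := by
    refine continuous_matFun hψ ((continuous_const.mul hB).mul continuous_const) fun x => ?_
    have := isHermitian_conjTranspose_mul_mul (matFun (fun x => (Real.sqrt x)⁻¹) A) (hB' x)
    rwa [(isHermitian_matFun _ A).eq] at this
  exact (continuous_const.mul h).mul continuous_const

variable {p q r : ℝ}

theorem kuboMean_symMat_proj (hψ : ψ 0 = 0) (hp : 0 ≤ p) (hq : 0 ≤ q) (hpq : p + q = 1)
    (hr : r * r = p * q) {x y : ℝ} (hx : 0 < x) (hy : 0 < y) :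
    kuboMean ψ (symMat x 0 y) (symMat p r q) =
      (ψ (p / x + q / y) / (p / x + q / y)) • symMat p r q := by
  have hA : (symMat x 0 y).PosDef := symMat_posDef hx hy (by nlinarith [mul_pos hx hy])
  have h1 := sqrt_mul_invSqrt hA
  have h2 := invSqrt_mul_sqrt hA
  have hRR : matFun (fun x => (Real.sqrt x)⁻¹) (symMat x 0 y) *
      matFun (fun x => (Real.sqrt x)⁻¹) (symMat x 0 y) = symMat x⁻¹ 0 y⁻¹ := by
    rw [← matFun_mul hA.isHermitian, matFun_diag, ← mul_inv, ← mul_inv,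
      Real.mul_self_sqrt hx.le, Real.mul_self_sqrt hy.le]
  have hRH := isHermitian_matFun (fun x => (Real.sqrt x)⁻¹) (symMat x 0 y)
  have hPAP := proj_mul_diag_mul_proj hr x⁻¹ y⁻¹
  rw [← div_eq_mul_inv, ← div_eq_mul_inv] at hPAP
  have hlam : 0 < p / x + q / y := by
    rcases hp.eq_or_lt with rfl | hp
    · rw [show q = 1 by linarith]; positivity
    · positivity
  rw [kuboMean]
  set P := symMat p r q with hP
  set S := matFun Real.sqrt (symMat x 0 y)
  set R := matFun (fun x => (Real.sqrt x)⁻¹) (symMat x 0 y)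
  set l := p / x + q / y
  set Q := l⁻¹ • (R * P * R) with hQ
  have hMM : (R * P * R) * (R * P * R) = l • (R * P * R) := by
    calc (R * P * R) * (R * P * R) = R * (P * (R * R) * P) * R := by simp only [mul_assoc]
      _ = l • (R * P * R) := by rw [hRR, hPAP, mul_smul_comm, smul_mul_assoc]
  have hMH : (R * P * R).IsHermitian := by
    have := isHermitian_conjTranspose_mul_mul R (symMat_isHermitian p r q)
    rwa [hRH.eq] at this
  have hQQ : Q * Q = Q := by
    rw [hQ, smul_mul_assoc, mul_smul_comm, hMM, smul_smul, smul_smul,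
      inv_mul_cancel_right₀ hlam.ne']
  have hQH : Q.IsHermitian := IsSelfAdjoint.smul (IsSelfAdjoint.all l⁻¹) hMH
  have hM : R * P * R = l • Q + (0 : ℝ) • (1 - Q) := by
    rw [hQ, smul_smul, mul_inv_cancel₀ hlam.ne', one_smul, zero_smul, add_zero]
  have hSMS : S * (R * P * R) * S = P := by
    calc S * (R * P * R) * S = (S * R) * P * (R * S) := by simp only [mul_assoc]
      _ = P := by rw [h1, h2, one_mul, mul_one]
  rw [hM, matFun_proj hQH hQQ, hψ, zero_smul, add_zero, hQ, smul_smul, mul_smul_comm,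
    smul_mul_assoc, hSMS, div_eq_mul_inv]

theorem PreservesMean.apply_proj (h : PreservesMean ψ g) (hgpos : ∀ t, 0 < t → 0 < g t)
    (hψpos : ∀ t, 0 < t → 0 < ψ t) (hg1 : g 1 = 1)
    (hgc : ContinuousOn g (Ioi 0)) (hψc : ContinuousOn ψ (Ioi 0))
    (hg0 : Tendsto g (𝓝[>] 0) (𝓝 0)) (hψ0 : Tendsto ψ (𝓝[>] 0) (𝓝 0))
    (hp : 0 ≤ p) (hq : 0 ≤ q) (hpq : p + q = 1) {x y : ℝ} (hx : 0 < x) (hy : 0 < y) :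
    g (ψ (p / x + q / y) / (p / x + q / y)) =
      ψ (p / g x + q / g y) / (p / g x + q / g y) := by
  have hr : √(p * q) * √(p * q) = p * q := Real.mul_self_sqrt (by positivity)
  set r := √(p * q)
  have hA : (symMat x 0 y).PosDef := symMat_posDef hx hy (by nlinarith [mul_pos hx hy])
  have hlam : ∀ {x y : ℝ}, 0 < x → 0 < y → 0 < p / x + q / y := by
    intro x y hx hy
    rcases hp.eq_or_lt with rfl | hp
    · rw [show q = 1 by linarith]; positivity
    · positivity
  set g' : ℝ → ℝ := fun t => if t ≤ 0 then 0 else g t with hg'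
  set ψ' : ℝ → ℝ := fun t => if t ≤ 0 then 0 else ψ t with hψ'
  have hgg : ∀ t, 0 < t → g t = g' t := fun t ht => by rw [hg']; simp only [if_neg (not_le.2 ht)]
  have hψψ : ∀ t, 0 < t → ψ t = ψ' t := fun t ht => by rw [hψ']; simp only [if_neg (not_le.2 ht)]
  have hg'0 : g' 0 = 0 := by simp [hg']
  have hψ'0 : ψ' 0 = 0 := by simp [hψ']
  have hg'c : Continuous g' := continuous_extend_zero hgc hg0
  have hψ'c : Continuous ψ' := continuous_extend_zero hψc hψ0
  set B : ℝ → Matrix (Fin 2) (Fin 2) ℂ :=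
    fun e => (1 : ℝ) • symMat p r q + e • (1 - symMat p r q) with hB
  have hBc : Continuous B := by fun_prop
  have hBH : ∀ e, (B e).IsHermitian := fun e => by
    rw [hB]
    simp only [smul_proj_add hpq]
    exact symMat_isHermitian _ _ _
  have hL : Continuous fun e => matFun g' (kuboMean ψ' (symMat x 0 y) (B e)) := by
    refine continuous_matFun hg'c (continuous_kuboMean hψ'c _ hBc hBH) fun e => ?_
    have := isHermitian_conjTranspose_mul_mul (matFun Real.sqrt (symMat x 0 y))
      (isHermitian_matFun ψ' (matFun (fun x => (Real.sqrt x)⁻¹) (symMat x 0 y) * B e *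
        matFun (fun x => (Real.sqrt x)⁻¹) (symMat x 0 y)))
    rwa [(isHermitian_matFun _ _).eq] at this
  have hR : Continuous fun e => kuboMean ψ' (symMat (g x) 0 (g y)) (matFun g' (B e)) :=
    continuous_kuboMean hψ'c _ (continuous_matFun hg'c hBc hBH) fun e => isHermitian_matFun _ _
  have heq : ∀ e, 0 < e → matFun g' (kuboMean ψ' (symMat x 0 y) (B e)) =
      kuboMean ψ' (symMat (g x) 0 (g y)) (matFun g' (B e)) := by
    intro e he
    have hBe : (B e).PosDef := posDef_proj hp hq hpq hr one_pos he
    have h1 := h 2 _ _ hA hBe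
    rwa [matFun_congr (posDef_kuboMean hA hBe hψpos) hgg, kuboMean_congr hA hBe hψψ,
      kuboMean_congr (posDef_matFun hA hgpos) (posDef_matFun hBe hgpos) hψψ,
      matFun_congr hBe hgg, matFun_diag] at h1
  have hlim : matFun g' (kuboMean ψ' (symMat x 0 y) (B 0)) =
      kuboMean ψ' (symMat (g x) 0 (g y)) (matFun g' (B 0)) := by
    refine tendsto_nhds_unique (hL.continuousWithinAt (s := Ioi 0) (x := 0)).tendsto
      ((hR.continuousWithinAt (s := Ioi 0) (x := 0)).tendsto.congr' ?_)
    filter_upwards [eventually_mem_nhdsWithin] with e he using (heq e he).symm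
  have hB0 : B 0 = symMat p r q := by rw [hB]; simp
  have hgB0 : matFun g' (B 0) = symMat p r q := by
    rw [hB]
    simp only
    rw [matFun_symMat_proj hpq hr, hg'0, ← hgg 1 one_pos, hg1, one_smul, zero_smul, add_zero]
  have hprojg : ∀ s : ℝ, matFun g' (s • symMat p r q) = g' s • symMat p r q := fun s => by
    have := matFun_symMat_proj hpq hr g' s 0
    rwa [hg'0, zero_smul, add_zero, add_zero] at this
  rw [hgB0, hB0, kuboMean_symMat_proj hψ'0 hp hq hpq hr hx hy,
    kuboMean_symMat_proj hψ'0 hp hq hpq hr (hgpos x hx) (hgpos y hy), hprojg] at hlim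
  have hl := hlam hx hy
  rw [← hψψ _ hl, ← hψψ _ (hlam (hgpos x hx) (hgpos y hy)),
    ← hgg _ (div_pos (hψpos _ hl) hl)] at hlim
  have htr := congrArg Matrix.trace hlim
  rw [Matrix.trace_smul, Matrix.trace_smul] at htr
  have ht1 : (symMat p r q).trace = 1 := by
    rw [symMat, Matrix.trace_fin_two_of]
    exact_mod_cast hpq
  rw [ht1] at htr
  simp only [Complex.real_smul, mul_one] at htr
  exact_mod_cast htr

end Projections

section Affine

variable {f Φ : ℝ → ℝ}

theorem OMone.continuousOn_adjFun (hf : OMone f) : ContinuousOn (adjFun f) (Ioi 0) :=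
  hf.adjFun_concaveOn.continuousOn isOpen_Ioi

theorem PreservesMean.apply_convex_comb (hf : OMone f) (hΦ : OMone Φ) (hfnt : ¬ OMTrivial f)
    (hΦnt : ¬ OMTrivial Φ) (hΦ0 : Tendsto (adjFun Φ) (𝓝[>] 0) (𝓝 0)) (h : PreservesMean Φ f)
    {p q X Y : ℝ} (hp : 0 ≤ p) (hq : 0 ≤ q) (hpq : p + q = 1) (hX : 0 < X) (hY : 0 < Y) :
    f (p * X + q * Y) = p * f X + q * f Y := by
  have hadj := h.adjoint hΦ.1 hf.1
  have hg0 := hf.tendsto_adjFun_zero hΦ hfnt hΦnt hΦ0 h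
  have key : ∀ {p q : ℝ}, 0 ≤ p → 0 ≤ q → p + q = 1 → ∀ {X Y : ℝ}, 0 < X → 0 < Y →
      f (adjFun Φ (p * X + q * Y) / (p * X + q * Y))⁻¹ =
        (adjFun Φ (p * f X + q * f Y) / (p * f X + q * f Y))⁻¹ := by
    intro p q hp hq hpq X Y hX hY
    have h1 := hadj.apply_proj (fun t ht => hf.adjFun_pos ht) (fun t ht => hΦ.adjFun_pos ht)
      hf.adjFun_one hf.continuousOn_adjFun hΦ.continuousOn_adjFun hg0 hΦ0 hp hq hpq
      (inv_pos.2 hX) (inv_pos.2 hY)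
    have h2 : ∀ t, adjFun f t⁻¹ = (f t)⁻¹ := fun t => by rw [adjFun, inv_inv]
    rw [h2, h2] at h1
    simp only [div_inv_eq_mul] at h1
    rw [← h1]
    exact (inv_inv _).symm
  have hpos : ∀ {a b : ℝ}, 0 < a → 0 < b → 0 < p * a + q * b := by
    intro a b ha hb
    rcases hp.eq_or_lt with rfl | hp
    · rw [show q = 1 by linarith]; linarith
    · have := mul_nonneg hq hb.le
      positivity
  have h1 := key hp hq hpq hX hY
  have h2 := key zero_le_one le_rfl (add_zero 1) (hpos hX hY) (hpos hX hY)
  simp only [one_mul, zero_mul, add_zero] at h2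
  rw [h1] at h2
  exact (hΦ.adjFun_div_injOn hΦnt (hpos (hf.1 X hX) (hf.1 Y hY)) (hf.1 _ (hpos hX hY))
    (inv_injective h2)).symm

theorem mem_Ioo_of_eq_affine (hf : OMone f) (hnt : ¬ OMTrivial f) {a : ℝ}
    (h : ∀ t, 0 < t → f t = 1 + a * (t - 1)) : a ∈ Ioo (0 : ℝ) 1 := by
  have h0 : 0 ≤ a := by
    have h2 := hf.2.2.monotoneOn (mem_Ioi.2 one_pos) (mem_Ioi.2 two_pos) one_le_two
    rw [h 1 one_pos, h 2 two_pos] at h2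
    linarith
  have h1 : a ≤ 1 := by
    by_contra! ha
    have h3 := hf.1 ((a - 1) / a) (by apply div_pos <;> linarith)
    rw [h _ (by apply div_pos <;> linarith)] at h3
    have : a * ((a - 1) / a - 1) = -1 := by field_simp; ring
    linarith
  refine ⟨h0.lt_of_ne ?_, h1.lt_of_ne ?_⟩
  · rintro rfl
    exact hnt (Or.inl fun t ht => by rw [h t ht]; ring)
  · rintro rfl
    exact hnt (Or.inr fun t ht => by rw [h t ht]; ring)

theorem eq_affine_of_convex_comb (hf1 : f 1 = 1)
    (h : ∀ {p q X Y : ℝ}, 0 ≤ p → 0 ≤ q → p + q = 1 → 0 < X → 0 < Y →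
      f (p * X + q * Y) = p * f X + q * f Y) {t : ℝ} (ht : 0 < t) :
    f t = 1 + (f 2 - 1) * (t - 1) := by
  rcases le_or_gt t 1 with h1 | h1
  · have h2 := h (p := 1 / (2 - t)) (q := (1 - t) / (2 - t)) (X := t) (Y := 2)
      (div_nonneg zero_le_one (by linarith)) (div_nonneg (by linarith) (by linarith))
      (by field_simp [show 2 - t ≠ 0 by linarith]; ring) ht two_pos
    have h3 : 2 - t ≠ 0 := by linarith
    have h4 : 1 / (2 - t) * t + (1 - t) / (2 - t) * 2 = 1 := by field_simp; ring
    rw [h4, hf1] at h2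
    field_simp at h2
    linarith
  · rcases le_or_gt t 2 with h5 | h5
    · have h2 := h (p := 2 - t) (q := t - 1) (X := 1) (Y := 2) (by linarith) (by linarith) (by ring)
        one_pos two_pos
      rw [show (2 - t) * 1 + (t - 1) * 2 = t by ring, hf1] at h2
      linarith
    · have h3 : t - 1 ≠ 0 := by linarith
      have h2 := h (p := (t - 2) / (t - 1)) (q := 1 / (t - 1)) (X := 1) (Y := t)
        (div_nonneg (by linarith) (by linarith)) (div_nonneg (by linarith) (by linarith))
        (by field_simp; ring) one_pos ht
      have h4 : (t - 2) / (t - 1) * 1 + 1 / (t - 1) * t = 2 := by field_simp; ring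
      rw [h4, hf1] at h2
      field_simp at h2
      linarith

theorem PreservesMean.cross_ratio (h : PreservesMean Φ f) (hΦ : OMone Φ) {β : ℝ}
    (hβ : β ∈ Ioo (0 : ℝ) 1) (hf : ∀ t, 0 < t → f t = 1 + β * (t - 1)) {s t : ℝ} (ht : 0 < t)
    (hst : 0 < (s - 1) * (t - s)) : (Φ t - 1) * (s - 1) = (Φ s - 1) * (t - 1) := by
  obtain ⟨h0, h1⟩ := hβ
  have hts : t - s ≠ 0 := fun h => by rw [h, mul_zero] at hst; exact hst.false
  have hs1 : s - 1 ≠ 0 := fun h => by rw [h, zero_mul] at hst; exact hst.false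
  set a := (1 - β) * (s - 1) / (β * (t - s)) with ha
  have ha0 : 0 < a := by
    have : a = (1 - β) * ((s - 1) * (t - s)) / (β * ((t - s) * (t - s))) := by
      rw [ha]; field_simp
    rw [this]
    have := mul_self_pos.2 hts
    have := sub_pos.2 h1
    positivity
  have hfpos : ∀ t, 0 < t → 0 < f t := fun t ht => by
    rw [hf t ht]
    nlinarith [mul_pos h0 ht]
  have h2 := h.apply_scalar hfpos ha0 (mul_pos ht ha0)
  have hat : a * (β * (t - s)) = (1 - β) * (s - 1) := by
    rw [ha]; field_simp
  clear_value a
  have hfa := hfpos a ha0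
  have h3 : f (t * a) / f a = s := by
    rw [div_eq_iff hfa.ne', hf _ (mul_pos ht ha0), hf a ha0]
    linear_combination hat
  rw [mul_div_cancel_right₀ _ ha0.ne', h3, hf _ (mul_pos ha0 (hΦ.1 t ht)), hf a ha0] at h2
  have h4 : (1 - β) * ((Φ t - 1) * (s - 1) - (Φ s - 1) * (t - 1)) = 0 := by
    linear_combination (t - s) * h2 + (Φ s - Φ t) * hat
  rcases mul_eq_zero.1 h4 with h5 | h5
  · linarith
  · linarith

end Affine

section Main

variable {f Φ : ℝ → ℝ}

theorem preservesMean_of_affine {α β : ℝ} (hα : α ∈ Ioo (0 : ℝ) 1) (hβ : β ∈ Ioo (0 : ℝ) 1)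
    (hΦ : ∀ t : ℝ, 0 < t → Φ t = arithRep α t) (hf : ∀ t : ℝ, 0 < t → f t = arithRep β t) :
    PreservesMean Φ f := by
  intro n A B hA hB
  have hpos : ∀ {a : ℝ}, a ∈ Ioo (0 : ℝ) 1 → ∀ t, 0 < t → 0 < arithRep a t := fun ha t ht =>
    add_pos (sub_pos.2 ha.2) (mul_pos ha.1 ht)
  have hfpos : ∀ t, 0 < t → 0 < f t := fun t ht => hf t ht ▸ hpos hβ t ht
  have hΦpos : ∀ t, 0 < t → 0 < Φ t := fun t ht => hΦ t ht ▸ hpos hα t ht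
  have hM := posDef_kuboMean hA hB hΦpos
  rw [matFun_congr hM hf,
    kuboMean_congr (posDef_matFun hA hfpos) (posDef_matFun hB hfpos) hΦ, matFun_congr hA hf,
    matFun_congr hB hf]
  have hA' := posDef_matFun hA (hpos hβ)
  have hB' := posDef_matFun hB (hpos hβ)
  unfold arithRep at *
  rw [matFun_affine hM.isHermitian, kuboMean_congr hA hB hΦ, kuboMean_affine hA hB,
    kuboMean_affine hA' hB', matFun_affine hA.isHermitian, matFun_affine hB.isHermitian]
  module

theorem OMone.eq_affine_of_cross_ratio (hΦ : OMone Φ)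
    (h : ∀ {s t : ℝ}, 0 < t → 0 < (s - 1) * (t - s) →
      (Φ t - 1) * (s - 1) = (Φ s - 1) * (t - 1)) {t : ℝ} (ht : 0 < t) :
    Φ t = 1 + (Φ 2 - 1) * (t - 1) := by
  have hup : ∀ t, 1 ≤ t → Φ t = 1 + (Φ 2 - 1) * (t - 1) := by
    intro t ht
    rcases ht.eq_or_lt with rfl | ht1
    · rw [hΦ.2.1]; ring
    rcases lt_trichotomy t 2 with h2 | rfl | h2
    · have := h (s := t) two_pos (mul_pos (by linarith) (by linarith))
      linarith
    · ring
    · have := h (s := 2) (t := t) (by linarith) (mul_pos (by linarith) (by linarith))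
      linarith
  obtain ⟨n, hn⟩ : ∃ n, n = 2 * (1 - Φ (1 / 2)) := ⟨_, rfl⟩
  have hdown : ∀ t, 0 < t → t ≤ 1 → Φ t = 1 + n * (t - 1) := by
    intro t ht ht1
    rw [hn]
    rcases ht1.eq_or_lt with rfl | ht1
    · rw [hΦ.2.1]; ring
    rcases lt_trichotomy t (1 / 2) with h2 | rfl | h2
    · have := h (s := 1 / 2) ht (mul_pos_of_neg_of_neg (by linarith) (by linarith))
      linarith
    · ring
    · have := h (s := t) (t := 1 / 2) (by norm_num)
        (mul_pos_of_neg_of_neg (by linarith) (by linarith))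
      linarith
  have hm0 : 0 ≤ Φ 2 - 1 := by
    have := hΦ.2.2.monotoneOn (mem_Ioi.2 one_pos) (mem_Ioi.2 two_pos) one_le_two
    rw [hΦ.2.1] at this
    linarith
  set m := Φ 2 - 1
  have hmn : m ≤ n := by
    have h1 := hΦ.2.2.le_affine_of_eqOn_Ici (m := m) (c := 1 - m) one_pos hm0
      (fun t ht => by rw [hup t ht]; ring) (t := 1 / 2) (by norm_num)
    linarith
  have hnm : n - m ≤ 0 := by
    refine nonpos_of_forall_le_mul (M := n + m - 2 * n * m) one_pos fun δ h0 h1 => ?_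
    have hc := hΦ.adjFun_concaveOn.three_point (u := 1 - δ) (v := 1) (w := 1 + δ) (by linarith)
      (by linarith) (by linarith)
    have hp := hΦ.1 (1 - δ)⁻¹ (inv_pos.2 (by linarith))
    have hq := hΦ.1 (1 + δ)⁻¹ (inv_pos.2 (by linarith))
    rw [hΦ.adjFun_one, adjFun, adjFun] at hc
    have hP := hup (1 - δ)⁻¹ ((one_le_inv₀ (by linarith)).2 (by linarith))
    have hQ := hdown (1 + δ)⁻¹ (inv_pos.2 (by linarith)) (inv_le_one_of_one_le₀ (by linarith))
    have e1 : (1 - δ) * Φ (1 - δ)⁻¹ = 1 - δ + m * δ := by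
      rw [hP]
      have : 1 - δ ≠ 0 := by linarith
      field_simp
      ring
    have e2 : (1 + δ) * Φ (1 + δ)⁻¹ = 1 + δ - n * δ := by
      rw [hQ]
      have : 1 + δ ≠ 0 := by linarith
      field_simp
      ring
    generalize Φ (1 - δ)⁻¹ = P at *
    generalize Φ (1 + δ)⁻¹ = Q at *
    have hc1 : P + Q ≤ 2 * (P * Q) := by
      have hPQ : P⁻¹ + Q⁻¹ ≤ 2 := by
        have : δ * (P⁻¹ + Q⁻¹) ≤ δ * 2 := by linarith
        exact le_of_mul_le_mul_left this h0
      have := mul_le_mul_of_nonneg_left hPQ (mul_pos hp hq).le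
      have e : P * Q * (P⁻¹ + Q⁻¹) = P + Q := by field_simp; ring
      linarith
    have h3 := mul_le_mul_of_nonneg_left hc1
      (mul_pos (sub_pos.2 h1) (by linarith : 0 < 1 + δ)).le
    have e3 : (1 - δ) * (1 + δ) * (P + Q) =
        (1 + δ) * (1 - δ + m * δ) + (1 - δ) * (1 + δ - n * δ) := by
      rw [← e1, ← e2]; ring
    have e4 : (1 - δ) * (1 + δ) * (2 * (P * Q)) =
        2 * ((1 - δ + m * δ) * (1 + δ - n * δ)) := by
      rw [← e1, ← e2]; ring
    rw [e3, e4] at h3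
    have h4 : δ * (n - m) ≤ δ * (δ * (n + m - 2 * n * m)) := by linarith
    exact le_of_mul_le_mul_left h4 h0
  rcases le_total 1 t with h1 | h1
  · exact hup t h1
  · rw [hdown t ht h1, show n = m by linarith]

end Main

theorem stmt_10 (f Φ : ℝ → ℝ) (hf : OMone f) (hΦ : OMone Φ)
    (hfnt : ¬ OMTrivial f) (hΦnt : ¬ OMTrivial Φ)
    (hΦstar0 : Filter.Tendsto (adjFun Φ) (nhdsWithin 0 (Set.Ioi 0)) (nhds 0)) :
    PreservesMean Φ f ↔
      ∃ α ∈ Set.Ioo (0 : ℝ) 1, ∃ β ∈ Set.Ioo (0 : ℝ) 1,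
        (∀ t : ℝ, 0 < t → Φ t = arithRep α t) ∧ (∀ t : ℝ, 0 < t → f t = arithRep β t) := by
  constructor
  · intro h
    have hfa : ∀ t, 0 < t → f t = 1 + (f 2 - 1) * (t - 1) := fun t ht =>
      eq_affine_of_convex_comb hf.2.1
        (fun hp hq hpq hX hY => h.apply_convex_comb hf hΦ hfnt hΦnt hΦstar0 hp hq hpq hX hY) ht
    have hβ := mem_Ioo_of_eq_affine hf hfnt hfa
    have hΦa : ∀ t, 0 < t → Φ t = 1 + (Φ 2 - 1) * (t - 1) := fun t ht =>
      hΦ.eq_affine_of_cross_ratio (fun ht hst => h.cross_ratio hΦ hβ hfa ht hst) ht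
    refine ⟨Φ 2 - 1, mem_Ioo_of_eq_affine hΦ hΦnt hΦa, f 2 - 1, hβ, fun t ht => ?_,
      fun t ht => ?_⟩
    · rw [hΦa t ht, arithRep]; ring
    · rw [hfa t ht, arithRep]; ring
  · rintro ⟨α, hα, β, hβ, hΦa, hfa⟩
    exact preservesMean_of_affine hα hβ hΦa hfa
end
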